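/- arXiv:1911.04885 — 3 statements merged into one kernel-verified Lean document; each statement's English description precedes it below -/
import Mathlib

section
/- Let (X, Σ, μ) be a finite measure space and θ an N-function satisfying the Δ₂-condition: there exist k > 0 and x₀ ≥ 0 such that θ(2x) ≤ k θ(x) for all x ≥ x₀. Then the Orlicz class {f measurable : ∫ θ(|f|) dμ < ∞} is a linear space: it is closed under addition and under multiplication by arbitrary real scalars (in particular, if ∫ θ(|f|) dμ < ∞ then ∫ θ(|2f|) dμ < ∞). -/
open MeasureTheory Filter Topology ENNReal

/-- An N-function: continuous, convex, even, vanishing at 0, with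
`θ(u)/u → 0` as `u → 0⁺` and `θ(u)/u → ∞` as `u → ∞`. -/
def IsNFunction (θ : ℝ → ℝ) : Prop :=
  Continuous θ ∧ ConvexOn ℝ Set.univ θ ∧ (∀ x, θ (-x) = θ x) ∧ θ 0 = 0 ∧
  Tendsto (fun u => θ u / u) (nhdsWithin 0 (Set.Ioi 0)) (nhds 0) ∧
  Tendsto (fun u => θ u / u) atTop atTop

/-- The Luxemburg norm `inf { a > 0 : ∫ θ(|f|/a) dμ ≤ 1 }`, with `inf ∅ = ∞`. -/
noncomputable def luxNorm {X : Type*} [MeasurableSpace X] (μ : Measure X)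
    (θ : ℝ → ℝ) (f : X → ℝ) : ℝ≥0∞ :=
  ⨅ (a : ℝ) (_ : 0 < a) (_ : ∫⁻ x, ENNReal.ofReal (θ (|f x| / a)) ∂μ ≤ 1),
    ENNReal.ofReal a

lemma nf_nonneg {θ : ℝ → ℝ} (hθ : IsNFunction θ) (x : ℝ) : 0 ≤ θ x := by
  obtain ⟨-, hc, he, h0, -, -⟩ := hθ
  have h := hc.2 (Set.mem_univ x) (Set.mem_univ (-x))
    (by norm_num : (0 : ℝ) ≤ 1/2) (by norm_num : (0 : ℝ) ≤ 1/2) (by norm_num)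
  have e : (1/2 : ℝ) • x + (1/2 : ℝ) • (-x) = 0 := by simp
  rw [e, h0, he] at h
  simp only [smul_eq_mul] at h
  linarith

lemma nf_mono {θ : ℝ → ℝ} (hθ : IsNFunction θ) {a b : ℝ} (ha : 0 ≤ a) (hab : a ≤ b) :
    θ a ≤ θ b := by
  rcases eq_or_lt_of_le (ha.trans hab) with hb | hb
  · have : a = b := by linarith
    rw [this]
  have hn := nf_nonneg hθ b
  obtain ⟨-, hc, he, h0, -, -⟩ := hθ
  have ht : a / b ≤ 1 := (div_le_one hb).2 hab
  have h := hc.2 (Set.mem_univ b) (Set.mem_univ 0)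
    (by positivity : 0 ≤ a / b) (by linarith : 0 ≤ 1 - a / b) (by ring)
  have e : (a / b) • b + (1 - a / b) • (0 : ℝ) = a := by
    simp [hb.ne']
  rw [e, h0] at h
  simp only [smul_eq_mul] at h
  nlinarith

lemma nf_double {X : Type*} [MeasurableSpace X] (μ : Measure X)
    [IsFiniteMeasure μ] (θ : ℝ → ℝ) (hθ : IsNFunction θ)
    (hΔ₂ : ∃ k > (0 : ℝ), ∃ x₀ ≥ (0 : ℝ), ∀ x ≥ x₀, θ (2 * x) ≤ k * θ x)
    (f : X → ℝ) (h : ∫⁻ x, ENNReal.ofReal (θ |f x|) ∂μ < ⊤) :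
    ∫⁻ x, ENNReal.ofReal (θ |2 * f x|) ∂μ < ⊤ := by
  obtain ⟨k, hk, x₀, hx₀, hd⟩ := hΔ₂
  have key : ∀ x, ENNReal.ofReal (θ |2 * f x|) ≤
      ENNReal.ofReal k * ENNReal.ofReal (θ |f x|) + ENNReal.ofReal (θ (2 * x₀)) := by
    intro x
    rw [← ENNReal.ofReal_mul hk.le, ← ENNReal.ofReal_add
      (mul_nonneg hk.le (nf_nonneg hθ _)) (nf_nonneg hθ _)]
    apply ENNReal.ofReal_le_ofReal
    rw [abs_mul, abs_two]
    have h1 := mul_nonneg hk.le (nf_nonneg hθ |f x|)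
    have h2 := nf_nonneg hθ (2 * x₀)
    rcases le_total x₀ |f x| with hx | hx
    · linarith [hd _ hx]
    · have := nf_mono hθ (a := 2 * |f x|) (b := 2 * x₀) (by positivity) (by linarith)
      linarith
  refine (lintegral_mono key).trans_lt ?_
  rw [lintegral_add_right _ measurable_const, lintegral_const_mul' _ _ ENNReal.ofReal_ne_top,
    lintegral_const]
  exact ENNReal.add_lt_top.2 ⟨ENNReal.mul_lt_top ENNReal.ofReal_lt_top h,
    ENNReal.mul_lt_top ENNReal.ofReal_lt_top (measure_lt_top _ _)⟩

/-- For a finite measure and an N-function satisfying the Δ₂-condition,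
the Orlicz class is a linear space. -/
theorem orliczClass_linear_of_delta2 {X : Type*} [MeasurableSpace X] (μ : Measure X)
    [IsFiniteMeasure μ] (θ : ℝ → ℝ) (hθ : IsNFunction θ)
    (hΔ₂ : ∃ k > (0 : ℝ), ∃ x₀ ≥ (0 : ℝ), ∀ x ≥ x₀, θ (2 * x) ≤ k * θ x) :
    (∀ f g : X → ℝ, Measurable f → Measurable g →
        ∫⁻ x, ENNReal.ofReal (θ |f x|) ∂μ < ⊤ →
        ∫⁻ x, ENNReal.ofReal (θ |g x|) ∂μ < ⊤ →
        ∫⁻ x, ENNReal.ofReal (θ |f x + g x|) ∂μ < ⊤) ∧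
    (∀ (f : X → ℝ) (c : ℝ), Measurable f →
        ∫⁻ x, ENNReal.ofReal (θ |f x|) ∂μ < ⊤ →
        ∫⁻ x, ENNReal.ofReal (θ |c * f x|) ∂μ < ⊤) ∧
    (∀ f : X → ℝ, Measurable f →
        ∫⁻ x, ENNReal.ofReal (θ |f x|) ∂μ < ⊤ →
        ∫⁻ x, ENNReal.ofReal (θ |2 * f x|) ∂μ < ⊤) := by
  have hD := nf_double μ θ hθ hΔ₂
  refine ⟨?_, ?_, fun f _ h => hD f h⟩
  · intro f g hf hg h1 h2
    have key : ∀ x, ENNReal.ofReal (θ |f x + g x|) ≤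
        ENNReal.ofReal (θ |2 * f x|) + ENNReal.ofReal (θ |2 * g x|) := by
      intro x
      rw [← ENNReal.ofReal_add (nf_nonneg hθ _) (nf_nonneg hθ _)]
      apply ENNReal.ofReal_le_ofReal
      have n1 := nf_nonneg hθ |2 * f x|
      have n2 := nf_nonneg hθ |2 * g x|
      have ht := abs_add_le (f x) (g x)
      have e1 : |2 * f x| = 2 * |f x| := by rw [abs_mul, abs_two]
      have e2 : |2 * g x| = 2 * |g x| := by rw [abs_mul, abs_two]
      rcases le_total |f x| |g x| with hx | hx
      · have := nf_mono hθ (abs_nonneg (f x + g x)) (b := |2 * g x|) (by linarith)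
        linarith
      · have := nf_mono hθ (abs_nonneg (f x + g x)) (b := |2 * f x|) (by linarith)
        linarith
    refine (lintegral_mono key).trans_lt ?_
    have hm : Measurable fun x => ENNReal.ofReal (θ |2 * f x|) := by
      have hc := hθ.1.measurable
      exact (hc.comp (continuous_abs.measurable.comp (hf.const_mul 2))).ennreal_ofReal
    rw [lintegral_add_left hm]
    exact ENNReal.add_lt_top.2 ⟨hD f h1, hD g h2⟩
  · intro f c _ h
    have hp : ∀ n : ℕ, ∫⁻ x, ENNReal.ofReal (θ |2 ^ n * f x|) ∂μ < ⊤ := by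
      intro n
      induction n with
      | zero => simpa using h
      | succ n ih =>
        have := hD _ ih
        simpa only [pow_succ', mul_assoc] using this
    obtain ⟨n, hn⟩ := pow_unbounded_of_one_lt |c| (one_lt_two)
    refine (lintegral_mono fun x => ?_).trans_lt (hp n)
    apply ENNReal.ofReal_le_ofReal
    apply nf_mono hθ (abs_nonneg _)
    rw [abs_mul, abs_mul, abs_of_pos (by positivity : (0 : ℝ) < 2 ^ n)]
    exact mul_le_mul_of_nonneg_right hn.le (abs_nonneg _)
end

section
/- Let (X, Σ, μ) be a finite measure space and f : X → ℝ a measurable function. Then f is Lebesgue integrable with respect to μ if and only if there exists an N-function θ such that ∫ θ(|f|) dμ < ∞. (Equivalently, L¹(μ) is the union, over all N-functions θ, of the Orlicz classes {f measurable : ∫ θ(|f|) dμ < ∞}.) -/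
open MeasureTheory Filter Topology ENNReal

lemma dlvp_summable (c : ℕ → ℝ) (hc : ∀ n : ℕ, (n : ℝ) + 1 ≤ c n) (u : ℝ) :
    Summable (fun n => max (|u| - c n) 0) := by
  obtain ⟨N, hN⟩ := exists_nat_ge |u|
  refine summable_of_ne_finset_zero (s := Finset.range N) ?_
  intro n hn
  have h1 : N ≤ n := by simpa using hn
  have h2 : (N : ℝ) ≤ n := by exact_mod_cast h1
  have := hc n
  exact max_eq_right (by linarith)

lemma dlvp_isNFunction (c : ℕ → ℝ) (hc : ∀ n : ℕ, (n : ℝ) + 1 ≤ c n) :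
    IsNFunction (fun u => ∑' n, max (|u| - c n) 0) := by
  have hs := dlvp_summable c hc
  have hconv : ConvexOn ℝ Set.univ (fun u : ℝ => ∑' n, max (|u| - c n) 0) := by
    refine ⟨convex_univ, ?_⟩
    intro x _ y _ a b ha hb hab
    simp only [smul_eq_mul]
    rw [← tsum_mul_left, ← tsum_mul_left,
      ← ((hs x).mul_left a).tsum_add ((hs y).mul_left b)]
    refine (hs _).tsum_le_tsum ?_ (((hs x).mul_left a).add ((hs y).mul_left b))
    intro n
    have hx := le_max_left (|x| - c n) 0
    have hx0 := le_max_right (|x| - c n) 0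
    have hy := le_max_left (|y| - c n) 0
    have hy0 := le_max_right (|y| - c n) 0
    have habs : |a * x + b * y| ≤ a * |x| + b * |y| := by
      refine (abs_add_le _ _).trans ?_
      rw [abs_mul, abs_mul, abs_of_nonneg ha, abs_of_nonneg hb]
    have h1 := mul_le_mul_of_nonneg_left hx ha
    have h2 := mul_le_mul_of_nonneg_left hy hb
    have h3 : a * c n + b * c n = c n := by rw [← add_mul, hab, one_mul]
    refine max_le ?_ (by positivity)
    linarith
  have hsmall : ∀ u : ℝ, |u| ≤ 1 → ∑' n, max (|u| - c n) 0 = 0 := by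
    intro u hu
    have : ∀ n, max (|u| - c n) 0 = 0 := fun n => by
      have := hc n
      have h0 : (0 : ℝ) ≤ n := Nat.cast_nonneg n
      exact max_eq_right (by linarith)
    simp [this]
  refine ⟨?_, hconv, fun x => by simp, hsmall 0 (by simp), ?_, ?_⟩
  · have := hconv.continuousOn_interior
    simpa [continuousOn_univ] using this
  · refine tendsto_const_nhds.congr' ?_
    filter_upwards [Ioo_mem_nhdsGT (show (0 : ℝ) < 1 by norm_num)] with u hu
    rw [hsmall u (by rw [abs_of_pos hu.1]; exact hu.2.le)]
    simp
  · rw [tendsto_atTop]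
    intro b
    obtain ⟨N, hN⟩ := exists_nat_ge (2 * b)
    have hc0 : ∀ n, 0 ≤ c n := fun n => by
      have := hc n
      have h0 : (0 : ℝ) ≤ n := Nat.cast_nonneg n
      linarith
    filter_upwards [eventually_ge_atTop (2 * ∑ n ∈ Finset.range N, c n),
      eventually_gt_atTop 0] with u hu hu0
    rw [le_div_iff₀ hu0]
    have h1 : ∑ n ∈ Finset.range N, max (|u| - c n) 0 ≤ ∑' n, max (|u| - c n) 0 :=
      (hs u).sum_le_tsum _ (fun n _ => le_max_right _ _)
    have h2 : ∑ n ∈ Finset.range N, (u / 2) ≤ ∑ n ∈ Finset.range N, max (|u| - c n) 0 := by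
      refine Finset.sum_le_sum fun n hn => ?_
      have := Finset.single_le_sum (f := c) (fun i _ => hc0 i) hn
      refine le_trans ?_ (le_max_left _ _)
      rw [abs_of_pos hu0]
      linarith
    simp only [Finset.sum_const, Finset.card_range, nsmul_eq_mul] at h2
    nlinarith

lemma dlvp_tendsto {X : Type*} [MeasurableSpace X]
    (μ : Measure X) (f : X → ℝ) (hf : Measurable f) (hi : Integrable f μ) :
    Tendsto (fun k : ℕ => ∫⁻ x, ENNReal.ofReal (|f x| - k) ∂μ) atTop (𝓝 0) := by
  have h := tendsto_lintegral_of_dominated_convergence (μ := μ)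
    (F := fun (k : ℕ) x => ENNReal.ofReal (|f x| - k)) (f := fun _ => 0)
    (fun x => ENNReal.ofReal |f x|)
    (fun k => by
      have : Measurable fun x => |f x| := by simpa using hf.norm
      exact (this.sub_const _).ennreal_ofReal)
    (fun k => Eventually.of_forall fun x => ENNReal.ofReal_le_ofReal (by simp))
    (by
      have := hi.2
      rw [hasFiniteIntegral_iff_norm] at this
      simpa using this.ne)
    (Eventually.of_forall fun x => by
      refine tendsto_const_nhds.congr' ?_
      obtain ⟨N, hN⟩ := exists_nat_ge |f x|
      filter_upwards [eventually_ge_atTop N] with k hk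
      have : (N : ℝ) ≤ k := by exact_mod_cast hk
      exact (ENNReal.ofReal_of_nonpos (by linarith)).symm)
  simpa using h

/-- Over a finite measure space, `L¹(μ)` is the union of the Orlicz classes
over all N-functions. -/
theorem integrable_iff_mem_some_orliczClass {X : Type*} [MeasurableSpace X]
    (μ : Measure X) [IsFiniteMeasure μ] (f : X → ℝ) (hf : Measurable f) :
    Integrable f μ ↔
      ∃ θ : ℝ → ℝ, IsNFunction θ ∧ ∫⁻ x, ENNReal.ofReal (θ |f x|) ∂μ < ⊤ := by
  constructor
  · intro hi
    have ht := dlvp_tendsto μ f hf hi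
    have hex : ∀ n : ℕ, ∃ k : ℕ, n + 1 ≤ k ∧
        ∫⁻ x, ENNReal.ofReal (|f x| - k) ∂μ < (2⁻¹ : ℝ≥0∞) ^ n := by
      intro n
      have hpos : (0 : ℝ≥0∞) < (2⁻¹ : ℝ≥0∞) ^ n :=
        ENNReal.pow_pos (by simp) n
      exact ((eventually_ge_atTop (n + 1)).and (ht.eventually_lt_const hpos)).exists
    choose k hk1 hk2 using hex
    have hc : ∀ n : ℕ, (n : ℝ) + 1 ≤ (k n : ℝ) := fun n => by exact_mod_cast hk1 n
    refine ⟨_, dlvp_isNFunction (fun n => (k n : ℝ)) hc, ?_⟩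
    have hm : Measurable fun x => |f x| := by simpa using hf.norm
    have e : ∀ x, ENNReal.ofReal (∑' n, max (|(|f x|)| - (k n : ℝ)) 0)
        = ∑' n, ENNReal.ofReal (|f x| - k n) := by
      intro x
      rw [ENNReal.ofReal_tsum_of_nonneg (fun n => le_max_right _ _)
        (dlvp_summable (fun n => (k n : ℝ)) hc _)]
      simp [ENNReal.ofReal_max]
    simp only [e]
    rw [lintegral_tsum (fun n => ((hm.sub_const _).ennreal_ofReal).aemeasurable)]
    refine lt_of_le_of_lt (ENNReal.tsum_le_tsum fun n => (hk2 n).le) ?_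
    rw [ENNReal.tsum_geometric]
    simp
  · rintro ⟨θ, ⟨-, -, -, -, -, hθ⟩, hfin⟩
    refine ⟨hf.aestronglyMeasurable, ?_⟩
    rw [hasFiniteIntegral_iff_norm]
    obtain ⟨M, hM⟩ := eventually_atTop.1
      ((hθ.eventually_ge_atTop 1).and (eventually_gt_atTop 0))
    have hle : ∀ x, ENNReal.ofReal ‖f x‖ ≤ ENNReal.ofReal M + ENNReal.ofReal (θ |f x|) := by
      intro x
      rw [Real.norm_eq_abs]
      rcases le_total M |f x| with h | h
      · obtain ⟨h1, h2⟩ := hM _ h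
        rw [le_div_iff₀ h2, one_mul] at h1
        exact (ENNReal.ofReal_le_ofReal h1).trans le_add_self
      · exact (ENNReal.ofReal_le_ofReal h).trans le_self_add
    refine (lintegral_mono hle).trans_lt ?_
    rw [lintegral_add_left measurable_const, lintegral_const]
    exact ENNReal.add_lt_top.2 ⟨ENNReal.mul_lt_top ENNReal.ofReal_lt_top (measure_lt_top _ _), hfin⟩
end

section
/- Let (X, Σ, μ) be a σ-finite measure space and θ an N-function. If (f_n)_{n≥1} is a sequence of measurable functions X → ℝ, each with finite Luxemburg norm, that is Cauchy in the Luxemburg norm (for every ε > 0 there is N with ‖f_m − f_n‖_θ < ε for all m, n ≥ N), then there exists a measurable function f : X → ℝ with ‖f‖_θ < ∞ and ‖f_n − f‖_θ → 0. That is, the Orlicz space equipped with the Luxemburg norm is complete. -/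
open MeasureTheory Filter Topology ENNReal

namespace OrliczAux

lemma cvx {θ : ℝ → ℝ} (hc : ConvexOn ℝ Set.univ θ) (x y : ℝ) {a b : ℝ} (ha : 0 ≤ a)
    (hb : 0 ≤ b) (hab : a + b = 1) : θ (a * x + b * y) ≤ a * θ x + b * θ y := by
  have := hc.2 (Set.mem_univ x) (Set.mem_univ y) ha hb hab
  simpa only [smul_eq_mul] using this

lemma nonneg {θ : ℝ → ℝ} (h : IsNFunction θ) (x : ℝ) : 0 ≤ θ x := by
  obtain ⟨-, hc, he, h0, -, -⟩ := h
  have := cvx hc x (-x) (a := 1/2) (b := 1/2)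
    (by norm_num) (by norm_num) (by norm_num)
  rw [he x, show (1/2 * x + 1/2 * -x : ℝ) = 0 by ring, h0] at this
  linarith

lemma scale {θ : ℝ → ℝ} (h : IsNFunction θ) {t : ℝ} (ht0 : 0 ≤ t) (ht1 : t ≤ 1) (x : ℝ) :
    θ (t * x) ≤ t * θ x := by
  obtain ⟨-, hc, he, h0, -, -⟩ := h
  have := cvx hc x 0 (a := t) (b := 1 - t)
    ht0 (by linarith) (by ring)
  simpa [h0] using this

lemma mono {θ : ℝ → ℝ} (h : IsNFunction θ) {x y : ℝ} (hx : 0 ≤ x) (hxy : x ≤ y) :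
    θ x ≤ θ y := by
  rcases eq_or_lt_of_le (hx.trans hxy) with hy | hy
  · have : x = y := by linarith
    rw [this]
  · have h1 : x / y ≤ 1 := (div_le_one hy).2 hxy
    have := scale h (div_nonneg hx hy.le) h1 y
    rw [div_mul_cancel₀ _ hy.ne'] at this
    nlinarith [nonneg h y]

lemma exists_pos {θ : ℝ → ℝ} (h : IsNFunction θ) : ∃ u, 0 < u ∧ 0 < θ u := by
  obtain ⟨-, hc, he, h0, -, ht⟩ := h
  obtain ⟨u, hu, hu'⟩ := ((ht.eventually_gt_atTop 0).and (eventually_gt_atTop 0)).exists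
  refine ⟨u, hu', ?_⟩
  have := mul_pos hu hu'
  rwa [div_mul_cancel₀ _ hu'.ne'] at this

variable {X : Type*} [MeasurableSpace X] {μ : Measure X} {θ : ℝ → ℝ}

lemma lint_mono (h : IsNFunction θ) (f : X → ℝ) {a b : ℝ} (ha : 0 < a) (hab : a ≤ b)
    (hi : ∫⁻ x, ENNReal.ofReal (θ (|f x| / a)) ∂μ ≤ 1) :
    ∫⁻ x, ENNReal.ofReal (θ (|f x| / b)) ∂μ ≤ 1 := by
  refine (lintegral_mono fun x => ?_).trans hi
  apply ENNReal.ofReal_le_ofReal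
  apply mono h (div_nonneg (abs_nonneg _) (ha.trans_le hab).le)
  gcongr

lemma lint_of_lt (h : IsNFunction θ) (f : X → ℝ) {b : ℝ}
    (hf : luxNorm μ θ f < ENNReal.ofReal b) :
    ∫⁻ x, ENNReal.ofReal (θ (|f x| / b)) ∂μ ≤ 1 := by
  unfold luxNorm at hf
  simp only [iInf_lt_iff] at hf
  obtain ⟨a, ha, hi, hab⟩ := hf
  have hb := (ENNReal.ofReal_lt_ofReal_iff_of_nonneg ha.le).1 hab
  exact lint_mono h f ha hb.le hi

lemma lux_le (f : X → ℝ) {b : ℝ} (hb : 0 < b)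
    (hi : ∫⁻ x, ENNReal.ofReal (θ (|f x| / b)) ∂μ ≤ 1) :
    luxNorm μ θ f ≤ ENNReal.ofReal b :=
  iInf_le_of_le b (iInf_le_of_le hb (iInf_le_of_le hi le_rfl))

lemma meas (h : IsNFunction θ) {f : X → ℝ} (hf : Measurable f) (b : ℝ) :
    Measurable fun x => ENNReal.ofReal (θ (|f x| / b)) := by
  have h1 : Measurable fun x => |f x| := continuous_abs.measurable.comp hf
  exact ENNReal.measurable_ofReal.comp (h.1.measurable.comp (h1.div_const b))

lemma lux_sub_lt_top (h : IsNFunction θ) {f g : X → ℝ} (hfm : Measurable f)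
    (hf : luxNorm μ θ f < ⊤) (hg : luxNorm μ θ (fun x => f x - g x) < ⊤) :
    luxNorm μ θ g < ⊤ := by
  unfold luxNorm at hf hg
  simp only [iInf_lt_iff] at hf hg
  obtain ⟨a, ha, hia, -⟩ := hf
  obtain ⟨b, hb, hib, -⟩ := hg
  have hc : 0 < max a b := lt_max_of_lt_left ha
  have h1 := lint_mono h f ha (le_max_left a b) hia
  have h2 := lint_mono h (fun x => f x - g x) hb (le_max_right a b) hib
  set c := max a b
  refine (lux_le g (b := 2 * c) (by positivity) ?_).trans_lt ENNReal.ofReal_lt_top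
  have key : ∀ x, ENNReal.ofReal (θ (|g x| / (2 * c))) ≤
      ENNReal.ofReal (1/2) * ENNReal.ofReal (θ (|f x| / c)) +
      ENNReal.ofReal (1/2) * ENNReal.ofReal (θ (|f x - g x| / c)) := by
    intro x
    rw [← ENNReal.ofReal_mul (by norm_num), ← ENNReal.ofReal_mul (by norm_num),
      ← ENNReal.ofReal_add (mul_nonneg (by norm_num) (nonneg h _))
        (mul_nonneg (by norm_num) (nonneg h _))]
    apply ENNReal.ofReal_le_ofReal
    have hcv := cvx h.2.1 (|f x| / c) (|f x - g x| / c)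
      (a := 1/2) (b := 1/2) (by norm_num) (by norm_num) (by norm_num)
    refine (mono h (by positivity) ?_).trans hcv
    have : |g x| ≤ |f x| + |f x - g x| := by
      have := abs_sub (f x) (f x - g x)
      simpa using this
    calc |g x| / (2 * c) ≤ (|f x| + |f x - g x|) / (2 * c) := by gcongr
      _ = _ := by field_simp
  calc _ ≤ _ := lintegral_mono key
    _ = ENNReal.ofReal (1/2) * ∫⁻ x, ENNReal.ofReal (θ (|f x| / c)) ∂μ +
      ENNReal.ofReal (1/2) * ∫⁻ x, ENNReal.ofReal (θ (|f x - g x| / c)) ∂μ := by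
        rw [lintegral_add_left ((meas h hfm c).const_mul _),
          lintegral_const_mul' _ _ ENNReal.ofReal_ne_top,
          lintegral_const_mul' _ _ ENNReal.ofReal_ne_top]
    _ ≤ ENNReal.ofReal (1/2) * 1 + ENNReal.ofReal (1/2) * 1 := by gcongr
    _ = 1 := by
        rw [mul_one, ← ENNReal.ofReal_add (by norm_num) (by norm_num)]; norm_num

/-- Fast Cauchy sequences converge almost everywhere. -/
lemma ae_conv (h : IsNFunction θ) (F : ℕ → X → ℝ) (hF : ∀ n, Measurable (F n))
    (hd : ∀ k, ∫⁻ x, ENNReal.ofReal (θ (|F (k+1) x - F k x| / (1/4)^k)) ∂μ ≤ 1) :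
    ∀ᵐ x ∂μ, ∃ l, Tendsto (fun n => F n x) atTop (𝓝 l) := by
  have hm : ∀ k, Measurable fun x => ENNReal.ofReal (θ (|F (k+1) x - F k x| / (1/2)^k)) :=
    fun k => meas h ((hF (k+1)).sub (hF k)) _
  have hb : ∀ k, ∫⁻ x, ENNReal.ofReal (θ (|F (k+1) x - F k x| / (1/2)^k)) ∂μ ≤
      (2⁻¹ : ℝ≥0∞)^k := by
    intro k
    have : ∀ x, ENNReal.ofReal (θ (|F (k+1) x - F k x| / (1/2)^k)) ≤
        ENNReal.ofReal ((1/2)^k) *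
          ENNReal.ofReal (θ (|F (k+1) x - F k x| / (1/4)^k)) := by
      intro x
      rw [← ENNReal.ofReal_mul (by positivity)]
      apply ENNReal.ofReal_le_ofReal
      have := scale h (t := (1/2)^k) (by positivity)
        (pow_le_one₀ (by norm_num) (by norm_num)) (|F (k+1) x - F k x| / (1/4)^k)
      convert this using 2
      rw [show (1/4 : ℝ) = (1/2) * (1/2) by norm_num, mul_pow]
      field_simp
    calc _ ≤ _ := lintegral_mono this
      _ = _ := lintegral_const_mul' _ _ ENNReal.ofReal_ne_top
      _ ≤ ENNReal.ofReal ((1/2)^k) * 1 := by gcongr; exact hd k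
      _ = _ := by
        rw [mul_one, ENNReal.ofReal_pow (by norm_num), one_div,
          ENNReal.ofReal_inv_of_pos (by norm_num)]
        simp
  have hs : ∫⁻ x, ∑' k, ENNReal.ofReal (θ (|F (k+1) x - F k x| / (1/2)^k)) ∂μ ≠ ⊤ := by
    rw [lintegral_tsum fun k => (hm k).aemeasurable]
    refine ((ENNReal.tsum_le_tsum hb).trans_lt ?_).ne
    rw [ENNReal.tsum_geometric]
    simp
  obtain ⟨u, hu, hθu⟩ := exists_pos h
  filter_upwards [ae_lt_top (Measurable.ennreal_tsum hm) hs] with x hx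
  have ht := ENNReal.tendsto_atTop_zero_of_tsum_ne_top hx.ne
  have hev := ht.eventually_lt_const (ENNReal.ofReal_pos.2 hθu)
  obtain ⟨N, hN⟩ := eventually_atTop.1 hev
  have hle : ∀ k ≥ N, |F (k+1) x - F k x| ≤ u * (1/2)^k := by
    intro k hk
    have h1 := (ENNReal.ofReal_lt_ofReal_iff hθu).1 (hN k hk)
    by_contra! hcon
    have h2 : u ≤ |F (k+1) x - F k x| / (1/2)^k := by
      rw [le_div_iff₀ (by positivity)]; exact hcon.le
    exact absurd (mono h hu.le h2) (not_le.2 h1)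
  have hc : CauchySeq fun n => F (n + N) x := by
    refine cauchySeq_of_le_geometric (1/2) u (by norm_num) fun n => ?_
    rw [dist_comm, Real.dist_eq, show n + 1 + N = n + N + 1 by ring]
    refine (hle (n+N) (by omega)).trans ?_
    gcongr ?_ * ?_
    exact pow_le_pow_of_le_one (by norm_num) (by norm_num) (by omega)
  obtain ⟨l, hl⟩ := cauchySeq_tendsto_of_complete hc
  exact ⟨l, (tendsto_add_atTop_iff_nat N).1 hl⟩

end OrliczAux

/-- The Orlicz space with the Luxemburg norm is complete. -/
theorem orliczSpace_complete {X : Type*} [MeasurableSpace X] (μ : Measure X)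
    [SigmaFinite μ] (θ : ℝ → ℝ) (hθ : IsNFunction θ) (f : ℕ → X → ℝ)
    (hf : ∀ n, Measurable (f n)) (hfin : ∀ n, luxNorm μ θ (f n) < ⊤)
    (hcauchy : ∀ ε > (0 : ℝ), ∃ N : ℕ, ∀ m ≥ N, ∀ n ≥ N,
      luxNorm μ θ (fun x => f m x - f n x) < ENNReal.ofReal ε) :
    ∃ g : X → ℝ, Measurable g ∧ luxNorm μ θ g < ⊤ ∧
      Tendsto (fun n => luxNorm μ θ (fun x => f n x - g x)) atTop (nhds 0) := by
  have hp : ∀ k : ℕ, ∃ N : ℕ, ∀ m ≥ N, ∀ n ≥ N,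
      luxNorm μ θ (fun x => f m x - f n x) < ENNReal.ofReal ((1/4)^k) :=
    fun k => hcauchy _ (by positivity)
  obtain ⟨φ, hφ, hφ'⟩ := extraction_forall_of_eventually'
    (P := fun k N => ∀ m ≥ N, ∀ n ≥ N,
      luxNorm μ θ (fun x => f m x - f n x) < ENNReal.ofReal ((1/4)^k))
    (fun k => (hp k).imp fun N hN M hM m hm n hn => hN m (hM.trans hm) n (hM.trans hn))
  have hae := OrliczAux.ae_conv (μ := μ) hθ (fun k => f (φ k)) (fun k => hf _) fun k =>
    OrliczAux.lint_of_lt hθ (fun x => f (φ (k+1)) x - f (φ k) x)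
      (hφ' k _ (hφ.monotone (Nat.le_succ k)) _ le_rfl)
  obtain ⟨g, hg, hlim⟩ := measurable_limit_of_tendsto_metrizable_ae
    (fun k => (hf (φ k)).aemeasurable) hae
  have hmain : ∀ ε > (0 : ℝ), ∃ N, ∀ n ≥ N,
      luxNorm μ θ (fun x => f n x - g x) ≤ ENNReal.ofReal ε := by
    intro ε hε
    obtain ⟨N, hN⟩ := hcauchy ε hε
    refine ⟨N, fun n hn => OrliczAux.lux_le _ hε ?_⟩
    have h1 : ∀ᵐ x ∂μ, ENNReal.ofReal (θ (|f n x - g x| / ε)) =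
        liminf (fun k => ENNReal.ofReal (θ (|f n x - f (φ k) x| / ε))) atTop := by
      filter_upwards [hlim] with x hx
      refine (Tendsto.liminf_eq ?_).symm
      refine (ENNReal.continuous_ofReal.tendsto _).comp ((hθ.1.tendsto _).comp ?_)
      exact ((tendsto_const_nhds.sub hx).abs).div_const ε
    rw [lintegral_congr_ae h1]
    refine (lintegral_liminf_le fun k =>
      OrliczAux.meas hθ ((hf n).sub (hf (φ k))) ε).trans ?_
    refine liminf_le_of_frequently_le' (Eventually.frequently ?_)
    filter_upwards [eventually_ge_atTop N] with k hk
    exact OrliczAux.lint_of_lt hθ (fun x => f n x - f (φ k) x)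
      (hN n hn _ (hk.trans (hφ.id_le k)))
  refine ⟨g, hg, ?_, ?_⟩
  · obtain ⟨N, hN⟩ := hmain 1 one_pos
    exact OrliczAux.lux_sub_lt_top hθ (hf N) (hfin N)
      ((hN N le_rfl).trans_lt ENNReal.ofReal_lt_top)
  · rw [ENNReal.tendsto_atTop_zero]
    intro ε hε
    by_cases ht : ε = ⊤
    · exact ⟨0, fun n _ => ht ▸ le_top⟩
    · obtain ⟨N, hN⟩ := hmain ε.toReal (ENNReal.toReal_pos hε.ne' ht)
      exact ⟨N, fun n hn => (hN n hn).trans (ENNReal.ofReal_toReal ht).le⟩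
end
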